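/- Let r ≥ 2 and let G be an r-graph of order n. If α ≥ 1 and λ^(α)(G) = r!·e(G)/n^{r/α}, then G is regular. If α ≥ r and G is regular, then λ^(α)(G) = r!·e(G)/n^{r/α}. However, for every α with 1 ≤ α < r there exists a regular r-graph G (of some order n) with λ^(α)(G) > r!·e(G)/n^{r/α}. -/

import Mathlib

/-!
Common definitions: `r`-uniform hypergraphs on vertex set `Fin n`, the polyform,
the parameter `λ^(α)`, degrees, properties of `r`-graphs, blow-ups, extremal
numbers and chromatic numbers.
-/

open Finset

/-- An `r`-uniform hypergraph on the vertex set `Fin n`. -/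
structure HGraph (r n : ℕ) where
  edges : Finset (Finset (Fin n))
  uniform : ∀ e ∈ edges, e.card = r

namespace HGraph

/-- The polyform `P_G(x) = r! ∑_{e ∈ E(G)} ∏_{i ∈ e} x_i`. -/
noncomputable def polyform {r n : ℕ} (G : HGraph r n) (x : Fin n → ℝ) : ℝ :=
  (r.factorial : ℝ) * ∑ e ∈ G.edges, ∏ i ∈ e, x i

/-- `λ^(α)(G)`: the maximum of the polyform over the unit sphere of `ℓ^α`. -/
noncomputable def lam {r n : ℕ} (α : ℝ) (G : HGraph r n) : ℝ :=
  sSup {y : ℝ | ∃ x : Fin n → ℝ, (∑ i, |x i| ^ α) = 1 ∧ y = G.polyform x}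

/-- The degree of a vertex: the number of edges containing it. -/
def degree {r n : ℕ} (G : HGraph r n) (v : Fin n) : ℕ :=
  (G.edges.filter (fun e => v ∈ e)).card

/-- Maximum degree `Δ(G)`. -/
def maxDeg {r n : ℕ} (G : HGraph r n) : ℕ :=
  Finset.univ.sup G.degree

/-- Minimum degree `δ(G)`. -/
noncomputable def minDeg {r n : ℕ} (G : HGraph r n) : ℕ :=
  sInf (Set.range G.degree)

/-- `G` is regular if all vertices have equal degrees. -/
def Regular {r n : ℕ} (G : HGraph r n) : Prop :=
  ∀ u v : Fin n, G.degree u = G.degree v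

/-- The induced subgraph of `G` along the embedding `f`. -/
def induce {r n m : ℕ} (G : HGraph r n) (f : Fin m ↪ Fin n) : HGraph r m where
  edges := Finset.univ.filter (fun e : Finset (Fin m) => e.map f ∈ G.edges)
  uniform := by
    intro e he
    rw [Finset.mem_filter] at he
    have h2 := G.uniform _ he.2
    rwa [Finset.card_map] at h2

/-- A property of `r`-graphs: a family closed under isomorphism (relabeling). -/
def IsProperty {r : ℕ} (P : ∀ n, Set (HGraph r n)) : Prop :=
  ∀ n : ℕ, ∀ σ : Equiv.Perm (Fin n), ∀ G ∈ P n, G.induce σ.toEmbedding ∈ P n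

/-- A hereditary property: closed under taking induced subgraphs. -/
def Hereditary {r : ℕ} (P : ∀ n, Set (HGraph r n)) : Prop :=
  ∀ n m : ℕ, ∀ f : Fin m ↪ Fin n, ∀ G ∈ P n, G.induce f ∈ P m

/-- A monotone property: closed under taking subgraphs. -/
def MonotoneProp {r : ℕ} (P : ∀ n, Set (HGraph r n)) : Prop :=
  ∀ n m : ℕ, ∀ f : Fin m ↪ Fin n, ∀ G ∈ P n, ∀ H : HGraph r m,
    (∀ e ∈ H.edges, e.map f ∈ G.edges) → H ∈ P m

/-- `B`, together with the projection `φ : V(B) → V(G)`, is (a copy of) the blow-up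
`G(k 1, …, k n)` of `G`: the fiber over a vertex `i` of `G` has `k i` vertices, and the
edges of `B` are exactly the transversals of the classes corresponding to edges of `G`. -/
def IsBlowup {r n N : ℕ} (G : HGraph r n) (k : Fin n → ℕ)
    (B : HGraph r N) (φ : Fin N → Fin n) : Prop :=
  (∀ i : Fin n, (Finset.univ.filter (fun v => φ v = i)).card = k i) ∧
  ∀ s : Finset (Fin N), s ∈ B.edges ↔ (Set.InjOn φ ↑s ∧ s.image φ ∈ G.edges)

/-- A multiplicative property: contains all blow-ups of all of its members. -/
def MultiplicativeProp {r : ℕ} (P : ∀ n, Set (HGraph r n)) : Prop :=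
  ∀ n : ℕ, ∀ G ∈ P n, ∀ k : Fin n → ℕ, (∀ i, 0 < k i) →
    ∀ N : ℕ, ∀ B : HGraph r N, ∀ φ : Fin N → Fin n, IsBlowup G k B φ → B ∈ P N

/-- The extremal number `ex(P, n)`: the maximum number of edges of a member of `P`
of order `n`. -/
noncomputable def exP {r : ℕ} (P : ∀ n, Set (HGraph r n)) (n : ℕ) : ℕ :=
  sSup {m : ℕ | ∃ G ∈ P n, G.edges.card = m}

/-- `λ^(α)(P, n)`: the maximum of `λ^(α)(G)` over members `G` of `P` of order `n`. -/
noncomputable def lamP {r : ℕ} (α : ℝ) (P : ∀ n, Set (HGraph r n)) (n : ℕ) : ℝ :=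
  sSup {y : ℝ | ∃ G ∈ P n, y = lam α G}

/-- The chromatic number: the least `k` such that the vertices can be `k`-colored
with no monochromatic edge (i.e. partitioned into `k` edgeless sets). -/
noncomputable def chrom {r n : ℕ} (G : HGraph r n) : ℕ :=
  sInf {k : ℕ | ∃ c : Fin n → Fin k, ∀ e ∈ G.edges, ¬ ∀ u ∈ e, ∀ w ∈ e, c u = c w}

/-- The weak chromatic number: the least `k` such that the vertices can be `k`-colored
with every edge getting `r` distinct colors (every class meets every edge in ≤ 1 vertex). -/
noncomputable def wchrom {r n : ℕ} (G : HGraph r n) : ℕ :=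
  sInf {k : ℕ | ∃ c : Fin n → Fin k, ∀ e ∈ G.edges, Set.InjOn c ↑e}

/-- `Mon(H)`: the (monotone, hereditary) property of all `r`-graphs containing no
subgraph isomorphic to `H`. -/
def MonP {r h : ℕ} (H : HGraph r h) : ∀ n, Set (HGraph r n) :=
  fun n => {G | ¬ ∃ f : Fin h ↪ Fin n, ∀ e ∈ H.edges, e.map f ∈ G.edges}

end HGraph

open HGraph

namespace HGraph

theorem bddAbove_polyform {r n : ℕ} (G : HGraph r n) {α : ℝ} (hα : 0 < α) :
    BddAbove {y : ℝ | ∃ x : Fin n → ℝ, (∑ i, |x i| ^ α) = 1 ∧ y = G.polyform x} := by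
  refine ⟨r.factorial * ∑ _e ∈ G.edges, 1, ?_⟩
  rintro _ ⟨x, hx, rfl⟩
  have hle (i : Fin n) : |x i| ≤ 1 := by
    have h : |x i| ^ α ≤ 1 := hx ▸
      single_le_sum (f := fun j => |x j| ^ α) (fun j _ => by positivity) (mem_univ i)
    by_contra! hc
    exact absurd (Real.one_lt_rpow hc hα) (not_lt.mpr h)
  unfold polyform
  gcongr with e he
  calc ∏ i ∈ e, x i ≤ |∏ i ∈ e, x i| := le_abs_self _
    _ = ∏ i ∈ e, |x i| := abs_prod _ _
    _ ≤ 1 := prod_le_one (fun _ _ => abs_nonneg _) fun i _ => hle i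

theorem polyform_le_lam {r n : ℕ} (G : HGraph r n) {α : ℝ} (hα : 0 < α) {x : Fin n → ℝ}
    (hx : ∑ i, |x i| ^ α = 1) : G.polyform x ≤ lam α G :=
  le_csSup (G.bddAbove_polyform hα) ⟨x, hx, rfl⟩

theorem sum_edges_sum {r n : ℕ} (G : HGraph r n) (c : Fin n → ℝ) :
    ∑ e ∈ G.edges, ∑ i ∈ e, c i = ∑ i, G.degree i * c i := by
  have h (e : Finset (Fin n)) : ∑ i ∈ e, c i = ∑ i, if i ∈ e then c i else 0 := by simp
  simp_rw [h]
  rw [sum_comm]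
  refine sum_congr rfl fun i _ => ?_
  rw [← sum_filter, sum_const, nsmul_eq_mul, degree]

theorem polyform_rpow_div {r n : ℕ} (G : HGraph r n) (α : ℝ) {w : Fin n → ℝ}
    (hw : ∀ i, 0 ≤ w i) :
    G.polyform (fun i => (w i / n) ^ α⁻¹) =
      r.factorial * (∑ e ∈ G.edges, ∏ i ∈ e, w i ^ α⁻¹) / (n : ℝ) ^ ((r : ℝ) / α) := by
  have h : ∀ e ∈ G.edges, ∏ i ∈ e, (w i / n) ^ α⁻¹ =
      (∏ i ∈ e, w i ^ α⁻¹) / (n : ℝ) ^ ((r : ℝ) / α) := fun e he => by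
    simp_rw [Real.div_rpow (hw _) n.cast_nonneg]
    rw [prod_div_distrib, prod_const, G.uniform e he, ← Real.rpow_natCast,
      ← Real.rpow_mul n.cast_nonneg, div_eq_inv_mul (r : ℝ)]
  rw [polyform, sum_congr rfl h, ← sum_div, mul_div_assoc]

theorem sum_abs_rpow_div {n : ℕ} (hn : n ≠ 0) {α : ℝ} (hα : 0 < α) {w : Fin n → ℝ}
    (hw : ∀ i, 0 ≤ w i) (hs : ∑ i, w i = n) : ∑ i, |(w i / n) ^ α⁻¹| ^ α = 1 := by
  have h (i : Fin n) : |(w i / n) ^ α⁻¹| ^ α = w i / n := by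
    have := hw i
    rw [abs_of_nonneg (by positivity), Real.rpow_inv_rpow (by positivity) hα.ne']
  simp_rw [h]
  rw [← sum_div, hs, div_self (by exact_mod_cast hn)]

theorem hasDerivAt_sum_prod_rpow {r n : ℕ} (G : HGraph r n) (c : Fin n → ℝ) (β : ℝ) :
    HasDerivAt (fun s : ℝ => ∑ e ∈ G.edges, ∏ i ∈ e, (1 + s * c i) ^ β)
      (β * ∑ i, G.degree i * c i) 0 := by
  have h1 (i : Fin n) : HasDerivAt (fun s : ℝ => (1 + s * c i) ^ β) (c i * β) 0 := by
    have h := (((hasDerivAt_id (0 : ℝ)).mul_const (c i)).const_add 1).rpow_const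
      (p := β) (Or.inl (by simp))
    simpa using h
  have h2 : ∀ e ∈ G.edges, HasDerivAt (fun s : ℝ => ∏ i ∈ e, (1 + s * c i) ^ β)
      (∑ i ∈ e, c i * β) 0 := fun e _ => by
    have h := HasDerivAt.fun_finsetProd (u := e) fun i _ => h1 i
    simpa using h
  rw [← sum_edges_sum, mul_sum]
  refine (HasDerivAt.fun_sum h2).congr_deriv (sum_congr rfl fun e _ => ?_)
  rw [mul_sum]
  exact sum_congr rfl fun i _ => mul_comm _ _

theorem regular_of_lam_eq {r n : ℕ} (G : HGraph r n) {α : ℝ} (hα : 0 < α)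
    (h : lam α G = (r.factorial : ℝ) * G.edges.card / (n : ℝ) ^ ((r : ℝ) / α)) :
    Regular G := by
  intro u v
  rcases eq_or_ne u v with rfl | huv
  · rfl
  have hn : n ≠ 0 := by rintro rfl; exact u.elim0
  have hn' : (0 : ℝ) < n := by exact_mod_cast Nat.pos_of_ne_zero hn
  have key (w : Fin n → ℝ) (hw : ∀ i, 0 ≤ w i) (hs : ∑ i, w i = n) :
      ∑ e ∈ G.edges, ∏ i ∈ e, w i ^ α⁻¹ ≤ G.edges.card := by
    have h1 := G.polyform_le_lam hα (sum_abs_rpow_div hn hα hw hs)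
    rw [polyform_rpow_div G α hw, h, div_le_div_iff_of_pos_right (by positivity)] at h1
    exact le_of_mul_le_mul_left h1 (by positivity)
  let c : Fin n → ℝ := Pi.single u 1 - Pi.single v 1
  have hc (i : Fin n) : |c i| ≤ 1 := by
    simp only [c, Pi.sub_apply, Pi.single_apply]
    split_ifs <;> simp
  have hmax : IsLocalMax (fun s : ℝ => ∑ e ∈ G.edges, ∏ i ∈ e, (1 + s * c i) ^ α⁻¹) 0 := by
    filter_upwards [Metric.ball_mem_nhds (0 : ℝ) one_pos] with s hs
    rw [mem_ball_zero_iff, Real.norm_eq_abs] at hs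
    refine (key (fun i => 1 + s * c i) (fun i => ?_) ?_).trans_eq (by simp)
    · have : |s * c i| ≤ 1 := by
        rw [abs_mul]
        exact mul_le_one₀ hs.le (abs_nonneg _) (hc i)
      linarith [(abs_le.mp this).1]
    · simp [sum_add_distrib, ← mul_sum, c]
  have hd := hmax.hasDerivAt_eq_zero (G.hasDerivAt_sum_prod_rpow c α⁻¹)
  have hd' : (G.degree u : ℝ) - G.degree v = 0 := by
    have h2 := (mul_eq_zero.mp hd).resolve_left (inv_ne_zero hα.ne')
    simpa [c, mul_sub, sum_sub_distrib, Pi.single_apply] using h2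
  exact_mod_cast sub_eq_zero.mp hd'

/-- Weighted AM-GM with all weights `α⁻¹` and the remaining weight put on `1`. -/
theorem prod_rpow_inv_le {ι : Type*} (e : Finset ι) (he : 0 < e.card) {α : ℝ}
    (hα : e.card ≤ α) {w : ι → ℝ} (hw : ∀ i, 0 ≤ w i) :
    ∏ i ∈ e, w i ^ α⁻¹ ≤ 1 + α⁻¹ * ((∑ i ∈ e, w i) - e.card) := by
  have hr : (0 : ℝ) < e.card := by exact_mod_cast he
  have hα0 : 0 < α := hr.trans_le hα
  have amgm : ∏ i ∈ e, w i ^ (e.card : ℝ)⁻¹ ≤ ∑ i ∈ e, (e.card : ℝ)⁻¹ * w i :=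
    Real.geom_mean_le_arith_mean_weighted e (fun _ => (e.card : ℝ)⁻¹) w
      (fun _ _ => by positivity) (by simp [hr.ne']) fun i _ => hw i
  have hp : ∏ i ∈ e, w i ^ α⁻¹ = (∏ i ∈ e, w i ^ (e.card : ℝ)⁻¹) ^ (e.card / α) := by
    rw [← Real.finsetProd_rpow _ _ fun i _ => Real.rpow_nonneg (hw i) _]
    refine prod_congr rfl fun i _ => ?_
    rw [← Real.rpow_mul (hw i)]
    congr 1
    field_simp
  have hnn : 0 ≤ ∑ i ∈ e, (e.card : ℝ)⁻¹ * w i :=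
    sum_nonneg fun i _ => mul_nonneg (by positivity) (hw i)
  calc ∏ i ∈ e, w i ^ α⁻¹
      ≤ (∑ i ∈ e, (e.card : ℝ)⁻¹ * w i) ^ (e.card / α) := by
        rw [hp]
        exact Real.rpow_le_rpow (prod_nonneg fun i _ => Real.rpow_nonneg (hw i) _) amgm
          (by positivity)
    _ = (1 + ((∑ i ∈ e, (e.card : ℝ)⁻¹ * w i) - 1)) ^ (e.card / α) := by rw [add_sub_cancel]
    _ ≤ 1 + e.card / α * ((∑ i ∈ e, (e.card : ℝ)⁻¹ * w i) - 1) :=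
        rpow_one_add_le_one_add_mul_self (by linarith) (by positivity)
          ((div_le_one hα0).mpr hα)
    _ = 1 + α⁻¹ * ((∑ i ∈ e, w i) - e.card) := by
        rw [← mul_sum]
        field_simp

theorem Regular.lam_eq {r n : ℕ} (hr : 0 < r) {G : HGraph r n} {α : ℝ} (hα : r ≤ α)
    (hG : Regular G) :
    lam α G = (r.factorial : ℝ) * G.edges.card / (n : ℝ) ^ ((r : ℝ) / α) := by
  have hα0 : 0 < α := lt_of_lt_of_le (by exact_mod_cast hr) hα
  rcases Nat.eq_zero_or_pos n with rfl | hn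
  · have hE : G.edges = ∅ := by
      refine eq_empty_of_forall_notMem fun e he => hr.ne ?_
      rw [← G.uniform e he, eq_empty_of_isEmpty e, card_empty]
    simp [lam, hE]
  have hn' : (0 : ℝ) < n := by exact_mod_cast hn
  refine IsGreatest.csSup_eq ⟨⟨fun _ => (1 / n) ^ α⁻¹, ?_, ?_⟩, ?_⟩
  · exact sum_abs_rpow_div hn.ne' hα0 (w := fun _ => 1) (by simp) (by simp)
  · rw [polyform_rpow_div G α (w := fun _ => 1) (by simp)]
    simp
  rintro _ ⟨x, hx, rfl⟩
  have hw (i : Fin n) : 0 ≤ n * |x i| ^ α := by positivity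
  have hle : G.polyform x ≤ G.polyform fun i => (n * |x i| ^ α / n) ^ α⁻¹ := by
    have hroot (i : Fin n) : (n * |x i| ^ α / n) ^ α⁻¹ = |x i| := by
      rw [mul_div_cancel_left₀ _ hn'.ne', Real.rpow_rpow_inv (abs_nonneg _) hα0.ne']
    simp_rw [hroot, polyform]
    refine mul_le_mul_of_nonneg_left (sum_le_sum fun e _ => ?_) (by positivity)
    rw [← abs_prod]
    exact le_abs_self _
  refine hle.trans ?_
  rw [polyform_rpow_div G α hw]
  gcongr
  have hdeg (c : Fin n → ℝ) :
      ∑ e ∈ G.edges, ∑ i ∈ e, c i = G.degree ⟨0, hn⟩ * ∑ i, c i := by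
    rw [sum_edges_sum, mul_sum]
    exact sum_congr rfl fun i _ => by rw [hG i]
  have hcount : (G.edges.card : ℝ) * r = G.degree ⟨0, hn⟩ * n := by
    have h := hdeg fun _ => 1
    rw [sum_congr rfl fun e he => by rw [sum_const, G.uniform e he]] at h
    simpa using h
  calc ∑ e ∈ G.edges, ∏ i ∈ e, (n * |x i| ^ α) ^ α⁻¹
      ≤ ∑ e ∈ G.edges, (1 + α⁻¹ * ((∑ i ∈ e, n * |x i| ^ α) - r)) := by
        refine sum_le_sum fun e he => ?_
        rw [← G.uniform e he]
        exact prod_rpow_inv_le e (by rwa [G.uniform e he]) (by rwa [G.uniform e he]) hw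
    _ = G.edges.card := by
        rw [sum_add_distrib, ← mul_sum, sum_sub_distrib, hdeg, ← mul_sum, hx]
        simp [hcount]

/-- The `r`-graph formed by two disjoint edges. -/
def twoEdges (r : ℕ) : HGraph r (r + r) where
  edges := {univ.map (Fin.castAddEmb r), univ.map (Fin.natAddEmb r)}
  uniform := by
    intro e he
    rw [mem_insert, mem_singleton] at he
    rcases he with rfl | rfl <;> simp

theorem twoEdges_ne {r : ℕ} (hr : 0 < r) :
    (univ.map (Fin.castAddEmb r) : Finset (Fin (r + r))) ≠ univ.map (Fin.natAddEmb r) := by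
  intro h
  have h0 : Fin.castAddEmb r ⟨0, hr⟩ ∈ univ.map (Fin.natAddEmb r) :=
    h ▸ mem_map_of_mem _ (mem_univ _)
  obtain ⟨j, -, hj⟩ := mem_map.mp h0
  have := congrArg Fin.val hj
  simp at this
  omega

theorem card_twoEdges {r : ℕ} (hr : 0 < r) : (twoEdges r).edges.card = 2 :=
  card_pair (twoEdges_ne hr)

theorem regular_twoEdges (r : ℕ) : Regular (twoEdges r) := by
  have h (v : Fin (r + r)) : (twoEdges r).degree v = 1 := by
    rw [degree, twoEdges, card_eq_one]
    refine Fin.addCases (fun i => ?_) (fun i => ?_) v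
    · refine ⟨univ.map (Fin.castAddEmb r), ?_⟩
      have h1 : ∀ j : Fin r, Fin.natAdd r j ≠ Fin.castAdd r i := fun j hj => by
        have := congrArg Fin.val hj
        simp at this
        omega
      rw [filter_insert, filter_singleton]
      simp [h1, -Fin.natAdd_eq_addNat]
    · refine ⟨univ.map (Fin.natAddEmb r), ?_⟩
      have h1 : ∀ j : Fin r, Fin.castAdd r j ≠ Fin.natAdd r i := fun j hj => by
        have := congrArg Fin.val hj
        simp at this
        omega
      rw [filter_insert, filter_singleton]
      simp [h1, -Fin.natAdd_eq_addNat]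
  intro u v
  rw [h, h]

theorem lt_lam_twoEdges {r : ℕ} (hr : 0 < r) {α : ℝ} (hα : 0 < α) (hαr : α < r) :
    (r.factorial : ℝ) * (twoEdges r).edges.card / ((r + r : ℕ) : ℝ) ^ ((r : ℝ) / α) <
      lam α (twoEdges r) := by
  have hr' : (0 : ℝ) < r := by exact_mod_cast hr
  let w : Fin (r + r) → ℝ := Fin.append (fun _ => 2) fun _ => 0
  have hw (i : Fin (r + r)) : 0 ≤ w i :=
    Fin.addCases (fun i => by simp [w]) (fun i => by simp [w, -Fin.natAdd_eq_addNat]) i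
  have hs : ∑ i, w i = (r + r : ℕ) := by
    rw [Fin.sum_univ_add]
    simp [w, mul_two, -Fin.natAdd_eq_addNat]
  have hle := (twoEdges r).polyform_le_lam hα (sum_abs_rpow_div (by omega) hα hw hs)
  refine lt_of_lt_of_le ?_ hle
  rw [polyform_rpow_div _ _ hw, card_twoEdges hr]
  have hsum : ∑ e ∈ (twoEdges r).edges, ∏ i ∈ e, w i ^ α⁻¹ = (2 : ℝ) ^ ((r : ℝ) / α) := by
    rw [twoEdges, sum_pair (twoEdges_ne hr), prod_map, prod_map]
    simp only [w, Fin.castAddEmb_apply, Fin.natAddEmb_apply, Fin.append_left, Fin.append_right,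
      Real.zero_rpow (inv_ne_zero hα.ne'), prod_const, card_univ, Fintype.card_fin,
      zero_pow hr.ne', add_zero]
    rw [← Real.rpow_natCast, ← Real.rpow_mul (by norm_num), div_eq_inv_mul]
  rw [hsum]
  have h2 : (2 : ℝ) < 2 ^ ((r : ℝ) / α) := by
    have h := Real.rpow_lt_rpow_of_exponent_lt (x := 2) (by norm_num) ((one_lt_div hα).mpr hαr)
    rwa [Real.rpow_one] at h
  have hpos : (0 : ℝ) < ((r + r : ℕ) : ℝ) := by exact_mod_cast (by omega : 0 < r + r)
  push_cast at hpos ⊢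
  gcongr

end HGraph

/-- Proposition 4: if `α ≥ 1` and `λ^(α)(G) = r!·e(G)/n^{r/α}`,
then `G` is regular; if `α ≥ r` and `G` is regular, then equality holds; however, for
every `1 ≤ α < r` there is a regular `r`-graph with `λ^(α)(G) > r!·e(G)/n^{r/α}`. -/
theorem stmt3 (r : ℕ) (hr : 2 ≤ r) (α : ℝ) (hα : 1 ≤ α) :
    (∀ n : ℕ, ∀ G : HGraph r n,
      lam α G = (r.factorial : ℝ) * G.edges.card / (n : ℝ) ^ ((r : ℝ) / α) → Regular G) ∧
    (∀ n : ℕ, ∀ G : HGraph r n, (r : ℝ) ≤ α → Regular G →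
      lam α G = (r.factorial : ℝ) * G.edges.card / (n : ℝ) ^ ((r : ℝ) / α)) ∧
    (α < r → ∃ n : ℕ, ∃ G : HGraph r n, Regular G ∧
      (r.factorial : ℝ) * G.edges.card / (n : ℝ) ^ ((r : ℝ) / α) < lam α G) := by
  have hα0 : 0 < α := one_pos.trans_le hα
  have hr0 : 0 < r := two_pos.trans_le hr
  exact ⟨fun n G h => G.regular_of_lam_eq hα0 h, fun n G h hG => hG.lam_eq hr0 h,
    fun h => ⟨r + r, twoEdges r, regular_twoEdges r, lt_lam_twoEdges hr0 hα0 h⟩⟩
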